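/- arXiv:1208.1590 — 2 statements merged into one kernel-verified Lean document; each statement's English description precedes it below -/
import Mathlib

section
/- Let G_Q be the group ℂ^× × (ℂ^×)^n × ℤ^n × ℂ^× with multiplication (u₁,H₁,η₁,w₁)·(u₂,H₂,η₂,w₂) = (u₁u₂, H₁·H₂·η₁(u₂)⁻¹, η₁+η₂, w₁·w₂·χ_{η₁}(H₂)⁻¹·u₂^{Q(η₁,η₁)/2}). Then the center of G_Q is exactly {(1, H, 0, w) : H ∈ (ℂ^×)^n with χ_η(H) = 1 for all η ∈ ℤ^n, and w ∈ ℂ^×}. In particular the last ℂ^× factor is central, and the torus part of the center is the subgroup Z_Q = ∩_{η ∈ ℤ^n} ker χ_η. -/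
open Finset

namespace LoopTorusCenter

/-- The underlying set `ℂ^× × (ℂ^×)^n × ℤ^n × ℂ^×`. -/
abbrev Carrier (n : ℕ) := ℂˣ × (Fin n → ℂˣ) × (Fin n → ℤ) × ℂˣ

/-- `χ_η(H) = ∏_j H_j ^ Q(η, e_j)`. -/
noncomputable def chi {n : ℕ} (Q : (Fin n → ℤ) → (Fin n → ℤ) → ℤ)
    (η : Fin n → ℤ) (H : Fin n → ℂˣ) : ℂˣ :=
  ∏ j, H j ^ Q η (Pi.single j 1)

/-- The multiplication
`(u₁,H₁,η₁,w₁)·(u₂,H₂,η₂,w₂)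
  = (u₁u₂, H₁·H₂·η₁(u₂)⁻¹, η₁+η₂, w₁·w₂·χ_{η₁}(H₂)⁻¹·u₂^{Q(η₁,η₁)/2})`. -/
noncomputable def mul {n : ℕ} (Q : (Fin n → ℤ) → (Fin n → ℤ) → ℤ)
    (g₁ g₂ : Carrier n) : Carrier n :=
  (g₁.1 * g₂.1,
   fun j => g₁.2.1 j * g₂.2.1 j * (g₂.1 ^ g₁.2.2.1 j)⁻¹,
   g₁.2.2.1 + g₂.2.2.1,
   g₁.2.2.2 * g₂.2.2.2 * (chi Q g₁.2.2.1 g₂.2.1)⁻¹ * g₂.1 ^ (Q g₁.2.2.1 g₁.2.2.1 / 2))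

section Chi

variable {n : ℕ} (Q : (Fin n → ℤ) → (Fin n → ℤ) → ℤ)

theorem chi_one (η : Fin n → ℤ) : chi Q η 1 = 1 := by
  simp [chi]

theorem form_zero_left (haddl : ∀ a b c, Q (a + b) c = Q a c + Q b c) (c : Fin n → ℤ) :
    Q 0 c = 0 := by
  simpa using haddl 0 0 c

theorem chi_zero (haddl : ∀ a b c, Q (a + b) c = Q a c + Q b c) (H : Fin n → ℂˣ) :
    chi Q 0 H = 1 := by
  simp [chi, form_zero_left Q haddl]

end Chi

theorem eq_zero_of_forall_units_zpow_eq_one {k : ℤ} (h : ∀ v : ℂˣ, v ^ k = 1) : k = 0 := by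
  have h2 : (2 : ℂ) ^ k = 1 := by
    simpa using congrArg Units.val (h (Units.mk0 (2 : ℂ) two_ne_zero))
  have h2' : (2 : ℝ) ^ k = 1 := by simpa using congrArg norm h2
  exact (zpow_eq_one_iff_right₀ (by norm_num) (by norm_num)).1 h2'

/-- The center of the group `G_Q` is exactly
`{(1, H, 0, w) : χ_η(H) = 1 for all η ∈ ℤ^n, w ∈ ℂ^×}`; in particular the last `ℂ^×` factor
is central and the torus part of the center is `Z_Q = ∩_η ker χ_η`. -/
theorem center_eq (n : ℕ) (hn : 1 ≤ n)
    (Q : (Fin n → ℤ) → (Fin n → ℤ) → ℤ)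
    (hsymm : ∀ a b, Q a b = Q b a)
    (haddl : ∀ a b c, Q (a + b) c = Q a c + Q b c)
    (heven : ∀ a, Even (Q a a)) :
    {g : Carrier n | ∀ g' : Carrier n, mul Q g g' = mul Q g' g} =
      {g : Carrier n | g.1 = 1 ∧ g.2.2.1 = 0 ∧
        ∀ η : Fin n → ℤ, chi Q η g.2.1 = 1} := by
  have h0 := form_zero_left Q haddl
  have hchi0 := chi_zero Q haddl
  ext ⟨u, H, η, w⟩
  simp only [Set.mem_ofPred_eq]
  constructor
  · intro hc
    have hη : η = 0 := by
      funext j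
      refine eq_zero_of_forall_units_zpow_eq_one fun v => ?_
      simpa [mul] using congrFun (congrArg (fun g : Carrier n => g.2.1) (hc (v, 1, 0, 1))) j
    subst hη
    have hu : u = 1 := by
      simpa [mul] using congrFun (congrArg (fun g : Carrier n => g.2.1) (hc (1, 1, 1, 1))) ⟨0, hn⟩
    subst hu
    refine ⟨rfl, rfl, fun η => ?_⟩
    simpa [mul, hchi0] using congrArg (fun g : Carrier n => g.2.2.2) (hc (1, 1, η, 1))
  · rintro ⟨rfl, rfl, hH⟩ ⟨u', H', η', w'⟩
    simp [mul, hchi0, h0, hH, mul_comm]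

end LoopTorusCenter
end

section
/- Let V be the complex vector space of finitely supported functions ℤ^n → ℂ, with standard basis {v_λ}_{λ ∈ ℤ^n}. For (u,H,η,w) ∈ G_Q define the linear map ρ(u,H,η,w) : V → V on basis vectors by ρ(u,H,η,w)(v_λ) = w · u^{Q(λ+η,λ+η)/2} · χ_{λ+η}(H) · v_{λ+η}. Then each ρ(g) is a linear automorphism of V and ρ(g₁·g₂) = ρ(g₁) ∘ ρ(g₂) for all g₁, g₂ ∈ G_Q; i.e., ρ is a group homomorphism from G_Q to GL(V). (This is the verification that the formulas (eq. LTrep) of Section 4.1.1 define a representation of the centrally extended group.) -/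
open Finset

namespace LoopTorusRep

/-- The underlying set `ℂ^× × (ℂ^×)^n × ℤ^n × ℂ^×`. -/
abbrev Carrier (n : ℕ) := ℂˣ × (Fin n → ℂˣ) × (Fin n → ℤ) × ℂˣ

/-- `χ_η(H) = ∏_j H_j ^ Q(η, e_j)`. -/
noncomputable def chi {n : ℕ} (Q : (Fin n → ℤ) → (Fin n → ℤ) → ℤ)
    (η : Fin n → ℤ) (H : Fin n → ℂˣ) : ℂˣ :=
  ∏ j, H j ^ Q η (Pi.single j 1)

/-- The multiplication
`(u₁,H₁,η₁,w₁)·(u₂,H₂,η₂,w₂)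
  = (u₁u₂, H₁·H₂·η₁(u₂)⁻¹, η₁+η₂, w₁·w₂·χ_{η₁}(H₂)⁻¹·u₂^{Q(η₁,η₁)/2})`. -/
noncomputable def mul {n : ℕ} (Q : (Fin n → ℤ) → (Fin n → ℤ) → ℤ)
    (g₁ g₂ : Carrier n) : Carrier n :=
  (g₁.1 * g₂.1,
   fun j => g₁.2.1 j * g₂.2.1 j * (g₂.1 ^ g₁.2.2.1 j)⁻¹,
   g₁.2.2.1 + g₂.2.2.1,
   g₁.2.2.2 * g₂.2.2.2 * (chi Q g₁.2.2.1 g₂.2.1)⁻¹ * g₂.1 ^ (Q g₁.2.2.1 g₁.2.2.1 / 2))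

/-- `V` is the space of finitely supported functions `ℤ^n → ℂ`, with standard basis
`{v_λ}` given by `Finsupp.single λ 1`. -/
abbrev V (n : ℕ) := (Fin n → ℤ) →₀ ℂ

/-- The scalar `w · u^{Q(λ+η,λ+η)/2} · χ_{λ+η}(H)` (a unit of `ℂ`). -/
noncomputable def scal {n : ℕ} (Q : (Fin n → ℤ) → (Fin n → ℤ) → ℤ)
    (g : Carrier n) (lam : Fin n → ℤ) : ℂˣ :=
  g.2.2.2 * g.1 ^ (Q (lam + g.2.2.1) (lam + g.2.2.1) / 2) * chi Q (lam + g.2.2.1) g.2.1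

/-- The linear map `ρ(u,H,η,w)` determined on basis vectors by
`ρ(u,H,η,w)(v_λ) = w · u^{Q(λ+η,λ+η)/2} · χ_{λ+η}(H) · v_{λ+η}`. -/
noncomputable def rho {n : ℕ} (Q : (Fin n → ℤ) → (Fin n → ℤ) → ℤ)
    (g : Carrier n) : V n →ₗ[ℂ] V n :=
  Finsupp.lsum ℂ fun lam =>
    LinearMap.toSpanSingleton ℂ (V n)
      ((scal Q g lam : ℂ) • Finsupp.single (lam + g.2.2.1) (1 : ℂ))

theorem rho_single {n : ℕ} (Q : (Fin n → ℤ) → (Fin n → ℤ) → ℤ) (g : Carrier n)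
    (lam : Fin n → ℤ) :
    rho Q g (Finsupp.single lam 1) =
      (scal Q g lam : ℂ) • Finsupp.single (lam + g.2.2.1) (1 : ℂ) := by
  simp [rho]

theorem rho_bijective {n : ℕ} (Q : (Fin n → ℤ) → (Fin n → ℤ) → ℤ) (g : Carrier n) :
    Function.Bijective (rho Q g) := by
  let inv : V n →ₗ[ℂ] V n := Finsupp.lsum ℂ fun μ =>
    LinearMap.toSpanSingleton ℂ (V n)
      (((scal Q g (μ - g.2.2.1))⁻¹ : ℂˣ) • Finsupp.single (μ - g.2.2.1) (1 : ℂ))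
  have inv_single (μ : Fin n → ℤ) : inv (Finsupp.single μ 1) =
      ((scal Q g (μ - g.2.2.1))⁻¹ : ℂˣ) • Finsupp.single (μ - g.2.2.1) (1 : ℂ) := by
    simp [inv]
  have left_inv : inv ∘ₗ rho Q g = LinearMap.id := by
    refine Finsupp.lhom_ext' fun lam => LinearMap.ext_ring ?_
    simp only [LinearMap.comp_apply, Finsupp.lsingle_apply, LinearMap.id_apply, rho_single,
      map_smul, inv_single, add_sub_cancel_right]
    rw [← Units.smul_def, smul_inv_smul]
  have right_inv : rho Q g ∘ₗ inv = LinearMap.id := by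
    refine Finsupp.lhom_ext' fun lam => LinearMap.ext_ring ?_
    simp only [LinearMap.comp_apply, Finsupp.lsingle_apply, LinearMap.id_apply, inv_single,
      Units.smul_def, map_smul, rho_single, sub_add_cancel]
    rw [← Units.smul_def, ← Units.smul_def, inv_smul_smul]
  exact Function.bijective_iff_has_inverse.mpr
    ⟨inv, fun x => LinearMap.congr_fun left_inv x, fun x => LinearMap.congr_fun right_inv x⟩

theorem chi_add {n : ℕ} {Q : (Fin n → ℤ) → (Fin n → ℤ) → ℤ}
    (haddl : ∀ a b c, Q (a + b) c = Q a c + Q b c) (a b : Fin n → ℤ) (H : Fin n → ℂˣ) :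
    chi Q (a + b) H = chi Q a H * chi Q b H := by
  simp only [chi, haddl, zpow_add, Finset.prod_mul_distrib]

theorem apply_eq_sum_single {n : ℕ} {q : (Fin n → ℤ) → ℤ}
    (hadd : ∀ a b, q (a + b) = q a + q b) (a : Fin n → ℤ) :
    q a = ∑ j, a j * q (Pi.single j 1) := by
  let f : (Fin n → ℤ) →+ ℤ := AddMonoidHom.mk' q hadd
  have h := congrArg f (pi_eq_sum_univ' a)
  simpa only [map_sum, map_zsmul, smul_eq_mul, f, AddMonoidHom.mk'_apply] using h

theorem chi_zpow {n : ℕ} {Q : (Fin n → ℤ) → (Fin n → ℤ) → ℤ} (ν : Fin n → ℤ)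
    (haddr : ∀ b c, Q ν (b + c) = Q ν b + Q ν c) (u : ℂˣ) (η : Fin n → ℤ) :
    chi Q ν (fun j => u ^ η j) = u ^ Q ν η := by
  rw [apply_eq_sum_single haddr η]
  have h := map_sum (zpowersHom ℂˣ u).toAdditiveRight
    (fun j => η j * Q ν (Pi.single j 1)) Finset.univ
  simp only [chi, ← zpow_mul]
  exact h.symm

theorem chi_mul_mul_inv {n : ℕ} (Q : (Fin n → ℤ) → (Fin n → ℤ) → ℤ) (ν : Fin n → ℤ)
    (H K L : Fin n → ℂˣ) :
    chi Q ν (fun j => H j * K j * (L j)⁻¹) = chi Q ν H * chi Q ν K * (chi Q ν L)⁻¹ := by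
  simp only [chi, mul_zpow, inv_zpow, Finset.prod_mul_distrib, Finset.prod_inv_distrib]

theorem scal_mul {n : ℕ} {Q : (Fin n → ℤ) → (Fin n → ℤ) → ℤ}
    (hsymm : ∀ a b, Q a b = Q b a)
    (haddl : ∀ a b c, Q (a + b) c = Q a c + Q b c)
    (heven : ∀ a, Even (Q a a)) (g₁ g₂ : Carrier n) (lam : Fin n → ℤ) :
    scal Q (mul Q g₁ g₂) lam = scal Q g₂ lam * scal Q g₁ (lam + g₂.2.2.1) := by
  obtain ⟨u₁, H₁, η₁, w₁⟩ := g₁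
  obtain ⟨u₂, H₂, η₂, w₂⟩ := g₂
  have haddr (a b c : Fin n → ℤ) : Q a (b + c) = Q a b + Q a c := by
    rw [hsymm, haddl, hsymm b, hsymm c]
  simp only [scal, mul]
  rw [← add_assoc, add_right_comm lam η₁ η₂]
  generalize lam + η₂ = μ
  have hmul (k : ℤ) : (u₁ * u₂) ^ k = u₁ ^ k * u₂ ^ k := mul_zpow u₁ u₂ k
  rw [chi_mul_mul_inv, chi_zpow _ (haddr _), chi_add haddl μ η₁ H₂, hmul]
  have hexp : Q μ μ / 2 = Q η₁ η₁ / 2 + Q (μ + η₁) (μ + η₁) / 2 - Q (μ + η₁) η₁ := by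
    obtain ⟨a, ha⟩ := heven μ
    obtain ⟨b, hb⟩ := heven η₁
    have hs := hsymm η₁ μ
    simp only [haddl, haddr]
    omega
  have hpow (k l m : ℤ) : u₂ ^ (k + l - m) = u₂ ^ k * u₂ ^ l * (u₂ ^ m)⁻¹ := by
    rw [zpow_sub, zpow_add]
  rw [hexp, hpow]
  generalize Q η₁ η₁ / 2 = k
  generalize Q (μ + η₁) (μ + η₁) / 2 = l
  generalize Q (μ + η₁) η₁ = m
  generalize chi Q (μ + η₁) H₁ = x
  generalize chi Q μ H₂ = y
  generalize chi Q η₁ H₂ = z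
  calc
    _ = (z⁻¹ * z) * (w₂ * (u₂ ^ k * u₂ ^ l * (u₂ ^ m)⁻¹) * y * (w₁ * u₁ ^ l * x)) := by ac_rfl
    _ = _ := by rw [inv_mul_cancel, one_mul]

/-- The formulas of Section 4.1.1 define a representation: each `ρ(g)` acts on basis vectors
by `v_λ ↦ w · u^{Q(λ+η,λ+η)/2} · χ_{λ+η}(H) · v_{λ+η}`, each `ρ(g)` is a linear automorphism
of `V`, and `ρ(g₁·g₂) = ρ(g₁) ∘ ρ(g₂)`; i.e. `ρ` is a group homomorphism `G_Q → GL(V)`. -/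
theorem rho_isRepresentation (n : ℕ) (hn : 1 ≤ n)
    (Q : (Fin n → ℤ) → (Fin n → ℤ) → ℤ)
    (hsymm : ∀ a b, Q a b = Q b a)
    (haddl : ∀ a b c, Q (a + b) c = Q a c + Q b c)
    (heven : ∀ a, Even (Q a a)) :
    (∀ (g : Carrier n) (lam : Fin n → ℤ),
      rho Q g (Finsupp.single lam 1) =
        (scal Q g lam : ℂ) • Finsupp.single (lam + g.2.2.1) (1 : ℂ)) ∧
    (∀ g : Carrier n, Function.Bijective (rho Q g)) ∧
    (∀ g₁ g₂ : Carrier n, rho Q (mul Q g₁ g₂) = (rho Q g₁) ∘ₗ (rho Q g₂)) := by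
  refine ⟨rho_single Q, rho_bijective Q, fun g₁ g₂ => ?_⟩
  refine Finsupp.lhom_ext' fun lam => LinearMap.ext_ring ?_
  simp only [LinearMap.comp_apply, Finsupp.lsingle_apply, rho_single, map_smul,
    scal_mul hsymm haddl heven, smul_smul, Units.val_mul]
  rw [add_assoc, add_comm g₂.2.2.1]
  rfl

end LoopTorusRep
end
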